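/- (Polar decomposition of even spinor elements / existence of the Takabayashi angle.) Let ψ be an element of the even subalgebra of ℝ_{1,3} with ψψ̃ ≠ 0, and write ψψ̃ = s·1 + p·γ5 with s, p ∈ ℝ. Then there exist ρ > 0, β ∈ ℝ, and a rotor R (even element with RR̃ = 1) such that ψ = ρ^{1/2} · (cos(β/2) + sin(β/2)·γ5) · R, where ρ = √(s² + p²) and (cos β, sin β) = (s/ρ, p/ρ); in short, ψ = ρ^{1/2} e^{γ5 β/2} R. -/

import Mathlib

noncomputable section
open CliffordAlgebra

/-- The Minkowski quadratic form `Q(x) = x₀² - x₁² - x₂² - x₃²` on `ℝ⁴`. -/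
def Qmink : QuadraticForm ℝ (Fin 4 → ℝ) :=
  QuadraticMap.weightedSumSquares ℝ ![(1 : ℝ), -1, -1, -1]

/-- The spacetime algebra `ℝ_{1,3}`. -/
abbrev STA : Type := CliffordAlgebra Qmink

/-- The generating vectors `γ_μ = ι(e_μ)`. -/
def γ (μ : Fin 4) : STA := ι Qmink (Pi.single μ 1)

/-- The signs `η^{μμ} = diag(1,-1,-1,-1)`. -/
def ηsgn (μ : Fin 4) : ℝ := if μ = 0 then 1 else -1

/-- The raised-index vectors `γ^μ := η^{μμ} γ_μ`. -/
def γup (μ : Fin 4) : STA := ηsgn μ • γ μ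

/-- The bivector `γ21 := γ₂γ₁` (it squares to `-1`). -/
def γ21 : STA := γ 2 * γ 1

/-- `e^{θ γ21} := cos θ + (sin θ) γ21`. -/
def expG21 (θ : ℝ) : STA := algebraMap ℝ STA (Real.cos θ) + Real.sin θ • γ21

/-- The partial derivative `∂_μ f` of a function `f : ℝ⁴ → ℝ` at `x`. -/
def pd (μ : Fin 4) (f : (Fin 4 → ℝ) → ℝ) (x : Fin 4 → ℝ) : ℝ :=
  deriv (fun t : ℝ => f (x + t • (Pi.single μ 1 : Fin 4 → ℝ))) 0

/-- `f' ` is the `μ`-th partial derivative of the spacetime-algebra valued field `f`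
(tested against all real-linear functionals, since `STA` carries no topology). -/
def HasPDeriv (μ : Fin 4) (f f' : (Fin 4 → ℝ) → STA) : Prop :=
  ∀ (L : STA →ₗ[ℝ] ℝ) (x : Fin 4 → ℝ),
    HasDerivAt (fun t : ℝ => L (f (x + t • (Pi.single μ 1 : Fin 4 → ℝ)))) (L (f' x)) 0

/-- The pseudoscalar `γ5 := γ₀γ₁γ₂γ₃`. -/
def γ5 : STA := γ 0 * γ 1 * γ 2 * γ 3

theorem γ_mul_γ_of_ne {μ ν : Fin 4} (h : μ ≠ ν) : γ μ * γ ν = -(γ ν * γ μ) := by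
  rw [eq_neg_iff_add_eq_zero, γ, γ, ι_mul_ι_add_swap]
  have : QuadraticMap.polar Qmink (Pi.single μ 1) (Pi.single ν 1) = 0 := by
    fin_cases μ <;> fin_cases ν <;>
      simp_all [QuadraticMap.polar, Qmink, QuadraticMap.weightedSumSquares_apply,
        Fin.sum_univ_four]
  rw [this, map_zero]

theorem γ_mul_self (μ : Fin 4) : γ μ * γ μ = algebraMap ℝ STA (ηsgn μ) := by
  rw [γ, ι_sq_scalar]
  congr 1
  fin_cases μ <;>
    simp [ηsgn, Qmink, QuadraticMap.weightedSumSquares_apply, Fin.sum_univ_four]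

theorem γ_zero_mul_self : γ 0 * γ 0 = 1 := by simp [γ_mul_self, ηsgn]

theorem γ_mul_self_of_ne_zero {μ : Fin 4} (h : μ ≠ 0) : γ μ * γ μ = -1 := by
  simp [γ_mul_self, ηsgn, h]

theorem γ_mul_γ_mul_of_ne {μ ν : Fin 4} (h : μ ≠ ν) (x : STA) :
    γ μ * (γ ν * x) = -(γ ν * (γ μ * x)) := by
  rw [← mul_assoc, γ_mul_γ_of_ne h, neg_mul, mul_assoc]

theorem reverse_γ5 : reverse γ5 = γ5 := by
  have hrev (μ : Fin 4) : reverse (γ μ) = γ μ := reverse_ι _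
  have h {μ ν : Fin 4} (hlt : ν < μ) := γ_mul_γ_of_ne hlt.ne'
  have h' {μ ν : Fin 4} (hlt : ν < μ) := γ_mul_γ_mul_of_ne hlt.ne'
  simp [γ5, hrev, mul_assoc, h, h']

theorem γ5_mul_self : γ5 * γ5 = -1 := by
  have h {μ ν : Fin 4} (hlt : ν < μ) := γ_mul_γ_mul_of_ne hlt.ne'
  simp [γ5, mul_assoc, h, γ_mul_self_of_ne_zero, γ_zero_mul_self]

theorem γ5_mem_evenOdd_zero : γ5 ∈ evenOdd Qmink 0 := by
  rw [γ5, mul_assoc]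
  exact SetLike.mul_mem_graded (A := evenOdd Qmink) (i := 0) (j := 0)
    (ι_mul_ι_mem_evenOdd_zero _ _ _) (ι_mul_ι_mem_evenOdd_zero _ _ _)

/-- The `ℝ`-algebra embedding of `ℂ` in the spacetime algebra sending `I` to `γ5`. -/
def complexToSTA : ℂ →ₐ[ℝ] STA := Complex.liftAux γ5 γ5_mul_self

theorem complexToSTA_apply (z : ℂ) :
    complexToSTA z = algebraMap ℝ STA z.re + z.im • γ5 :=
  Complex.liftAux_apply _ _ _

theorem reverse_complexToSTA (z : ℂ) : reverse (complexToSTA z) = complexToSTA z := by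
  simp [complexToSTA_apply, reverse_γ5]

theorem complexToSTA_mem_evenOdd_zero (z : ℂ) : complexToSTA z ∈ evenOdd Qmink 0 := by
  rw [complexToSTA_apply]
  exact add_mem (SetLike.algebraMap_mem_graded (evenOdd Qmink) _)
    (Submodule.smul_mem _ _ γ5_mem_evenOdd_zero)

/-- Polar decomposition of even spinor elements (existence of the Takabayashi angle):
if `ψ` is even with `ψψ̃ = s + pγ5 ≠ 0`, then `ψ = ρ^{1/2} e^{γ5 β/2} R` with
`ρ = √(s² + p²)`, `(cos β, sin β) = (s/ρ, p/ρ)` and `R` a rotor. -/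
theorem statement13 (ψ : STA) (hψ : ψ ∈ evenOdd Qmink 0)
    (s p : ℝ) (hsp : ψ * reverse ψ = algebraMap ℝ STA s + p • γ5)
    (hne : ψ * reverse ψ ≠ 0) :
    ∃ (β : ℝ) (R : STA), R ∈ evenOdd Qmink 0 ∧ R * reverse R = 1 ∧
      Real.cos β = s / Real.sqrt (s ^ 2 + p ^ 2) ∧
      Real.sin β = p / Real.sqrt (s ^ 2 + p ^ 2) ∧
      ψ = Real.sqrt (Real.sqrt (s ^ 2 + p ^ 2)) •
        ((algebraMap ℝ STA (Real.cos (β / 2)) + Real.sin (β / 2) • γ5) * R) := by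
  set z : ℂ := ⟨s, p⟩
  have hψz : ψ * reverse ψ = complexToSTA z := by rw [hsp, complexToSTA_apply]
  have hz0 : z ≠ 0 := by
    intro h
    rw [h, map_zero] at hψz
    exact hne hψz
  have hnorm : Real.sqrt (s ^ 2 + p ^ 2) = ‖z‖ := by
    rw [Complex.norm_def, Complex.normSq_apply, sq, sq]
  rw [hnorm]
  set w : ℂ := Real.sqrt ‖z‖ * Complex.exp (((z.arg / 2 : ℝ) : ℂ) * Complex.I) with hw
  have hww : w * w = z := by
    have hsqrt : (Real.sqrt ‖z‖ : ℂ) * Real.sqrt ‖z‖ = ‖z‖ := by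
      rw [← Complex.ofReal_mul, Real.mul_self_sqrt (norm_nonneg z)]
    rw [hw, mul_mul_mul_comm, hsqrt, ← Complex.exp_add, ← add_mul, ← Complex.ofReal_add,
      add_halves, Complex.norm_mul_exp_arg_mul_I]
  have hw0 : w ≠ 0 := by
    intro h
    rw [h, mul_zero] at hww
    exact hz0 hww.symm
  have hwexp : complexToSTA w = Real.sqrt ‖z‖ •
      (algebraMap ℝ STA (Real.cos (z.arg / 2)) + Real.sin (z.arg / 2) • γ5) := by
    rw [hw, ← Complex.real_smul, map_smul, complexToSTA_apply, Complex.exp_ofReal_mul_I_re,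
      Complex.exp_ofReal_mul_I_im]
  refine ⟨z.arg, complexToSTA w⁻¹ * ψ, ?_, ?_, Complex.cos_arg hz0, Complex.sin_arg z, ?_⟩
  · exact SetLike.mul_mem_graded (A := evenOdd Qmink) (i := 0) (j := 0)
      (complexToSTA_mem_evenOdd_zero _) hψ
  · rw [reverse.map_mul, reverse_complexToSTA, mul_assoc, ← mul_assoc ψ, hψz, ← map_mul,
      ← map_mul, ← hww, mul_inv_cancel_right₀ hw0, inv_mul_cancel₀ hw0, map_one]
  · rw [← smul_mul_assoc, ← hwexp, ← mul_assoc, ← map_mul, mul_inv_cancel₀ hw0, map_one,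
      one_mul]
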